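/- arXiv:2407.02731 — 6 statements merged into one kernel-verified Lean document; each statement's English description precedes it below -/
import Mathlib

section
/- If G is a finite simple graph that is r-regular for some r > 0 (every vertex has degree exactly r), then the independence number of G is at most the matching number of G, i.e., α(G) ≤ μ(G). -/
/-- A set of vertices is independent: no two distinct vertices in it are adjacent. -/
def IsIndepVertexSet {V : Type*} (G : SimpleGraph V) (s : Set V) : Prop :=
  ∀ ⦃u⦄, u ∈ s → ∀ ⦃v⦄, v ∈ s → u ≠ v → ¬ G.Adj u v

/-- The independence number: the maximum cardinality of an independent set of vertices. -/
noncomputable def indepNum {V : Type*} (G : SimpleGraph V) : ℕ :=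
  sSup {n : ℕ | ∃ s : Set V, IsIndepVertexSet G s ∧ s.ncard = n}

/-- A set of edges of `G` that are pairwise disjoint (no two edges share an endpoint). -/
def IsMatchingEdgeSet {V : Type*} (G : SimpleGraph V) (M : Set (Sym2 V)) : Prop :=
  M ⊆ G.edgeSet ∧ M.Pairwise fun e f => ∀ v : V, v ∈ e → v ∉ f

/-- The matching number: the maximum cardinality of a set of pairwise disjoint edges. -/
noncomputable def matchNum {V : Type*} (G : SimpleGraph V) : ℕ :=
  sSup {n : ℕ | ∃ M : Set (Sym2 V), IsMatchingEdgeSet G M ∧ M.ncard = n}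

/-- In a regular graph of positive degree, every set of vertices can be matched injectively
into neighbours. -/
theorem SimpleGraph.IsRegularOfDegree.exists_injective_adj {V : Type*}
    {G : SimpleGraph V} [G.LocallyFinite] {r : ℕ} (h : G.IsRegularOfDegree r) (hr : 0 < r)
    (s : Set V) : ∃ f : s → V, Function.Injective f ∧ ∀ v : s, G.Adj v (f v) := by
  classical
  obtain ⟨f, hf, hadj⟩ := (Finset.all_card_le_biUnion_card_iff_exists_injective
    fun v : s => G.neighborFinset v).1 fun A => by
      refine Nat.le_of_mul_le_mul_right (Finset.card_mul_le_card_mul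
        (fun (a : s) b => G.Adj a b) (m := r) (n := r) (fun a ha => ?_) fun b _ => ?_) hr
      · rw [← h a, ← G.card_neighborFinset_eq_degree]
        refine Finset.card_le_card fun b hb => ?_
        exact Finset.mem_filter.2
          ⟨Finset.mem_biUnion.2 ⟨a, ha, hb⟩, (G.mem_neighborFinset _ _).1 hb⟩
      · rw [← h b, ← G.card_neighborFinset_eq_degree]
        refine Finset.card_le_card_of_injOn Subtype.val (fun a ha => ?_)
          Subtype.val_injective.injOn
        exact (G.mem_neighborFinset _ _).2 (Finset.mem_filter.1 ha).2.symm
  exact ⟨f, hf, fun v => (G.mem_neighborFinset _ _).1 (hadj v)⟩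

/-- The cardinality of a matching is at most the matching number. -/
theorem IsMatchingEdgeSet.ncard_le_matchNum {V : Type*} [Finite V] {G : SimpleGraph V}
    {M : Set (Sym2 V)} (hM : IsMatchingEdgeSet G M) : M.ncard ≤ matchNum G := by
  refine le_csSup ⟨Nat.card (Sym2 V), ?_⟩ ⟨M, hM, rfl⟩
  rintro _ ⟨N, -, rfl⟩
  exact Set.ncard_le_card N

/-- An independent set that can be matched injectively into neighbours yields a matching of the
same cardinality. -/
theorem IsIndepVertexSet.ncard_le_matchNum {V : Type*} [Finite V] {G : SimpleGraph V}
    {s : Set V} (hs : IsIndepVertexSet G s) {f : s → V} (hf : Function.Injective f)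
    (hadj : ∀ v : s, G.Adj v (f v)) : s.ncard ≤ matchNum G := by
  have hout (v w : s) : (v : V) ≠ f w := fun h =>
    hs w.2 v.2 (h ▸ (hadj w).ne) (h ▸ hadj w)
  have hinj : Function.Injective fun v : s => s((v : V), f v) := fun v w h => by
    rcases Sym2.eq_iff.1 h with ⟨h, -⟩ | ⟨h, -⟩
    · exact Subtype.ext h
    · exact (hout v w h).elim
  have hM : IsMatchingEdgeSet G (Set.range fun v : s => s((v : V), f v)) := by
    refine ⟨?_, ?_⟩
    · rintro _ ⟨v, rfl⟩
      exact hadj v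
    · rintro _ ⟨v, rfl⟩ _ ⟨w, rfl⟩ hne x hx hx'
      have hvw : v ≠ w := fun h => hne (h ▸ rfl)
      rcases Sym2.mem_iff.1 hx with rfl | rfl <;> rcases Sym2.mem_iff.1 hx' with h | h
      · exact hvw (Subtype.ext h)
      · exact hout v w h
      · exact hout w v h.symm
      · exact hvw (hf h)
  have hcard := hM.ncard_le_matchNum
  rwa [← Nat.card_coe_set_eq, Nat.card_range_of_injective hinj, Nat.card_coe_set_eq] at hcard

/-- If `G` is a finite simple graph that is `r`-regular for some `r > 0`, then
`α(G) ≤ μ(G)`. -/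
theorem indepNum_le_matchNum_of_regular {V : Type*} [Fintype V] (G : SimpleGraph V)
    (r : ℕ) (hr : 0 < r) (hreg : ∀ v : V, (G.neighborSet v).ncard = r) :
    indepNum G ≤ matchNum G := by
  classical
  have h : G.IsRegularOfDegree r := fun v => by
    rw [← hreg v, ← G.card_neighborSet_eq_degree, ← Nat.card_eq_fintype_card,
      Nat.card_coe_set_eq]
  refine csSup_le' ?_
  rintro _ ⟨s, hs, rfl⟩
  obtain ⟨f, hf, hadj⟩ := h.exists_injective_adj hr s
  exact hs.ncard_le_matchNum hf hadj
end

section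
/- If G is a finite simple connected cubic graph (every vertex has degree exactly 3), then the independence number of G is at most the matching number of G, i.e., α(G) ≤ μ(G). -/
/-- A regular graph of positive degree admits an injective choice of a neighbor of each vertex. -/
theorem exists_injective_adj_of_isRegularOfDegree {V : Type*} [Fintype V] {G : SimpleGraph V}
    [G.LocallyFinite] {d : ℕ} (hd : 0 < d) (hG : G.IsRegularOfDegree d) :
    ∃ f : V → V, Function.Injective f ∧ ∀ v, G.Adj v (f v) := by
  classical
  obtain ⟨f, hf, hadj⟩ :=
    (Finset.all_card_le_biUnion_card_iff_exists_injective fun v => G.neighborFinset v).1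
      fun A => by
        refine Nat.le_of_mul_le_mul_right
          (Finset.card_mul_le_card_mul (m := d) (n := d) G.Adj (fun a ha => ?_) fun b _ => ?_) hd
        · rw [← hG a, ← G.card_neighborFinset_eq_degree]
          refine Finset.card_le_card fun b hb => ?_
          exact (Finset.mem_bipartiteAbove _).2
            ⟨Finset.mem_biUnion.2 ⟨a, ha, hb⟩, (G.mem_neighborFinset a b).1 hb⟩
        · rw [← hG b, ← G.card_neighborFinset_eq_degree]
          refine Finset.card_le_card fun a ha => ?_
          exact (G.mem_neighborFinset b a).2 ((Finset.mem_bipartiteBelow _).1 ha).2.symm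
  exact ⟨f, hf, fun v => (G.mem_neighborFinset v (f v)).1 (hadj v)⟩

/-- An injective choice of neighbors matches an independent set into its complement. -/
theorem exists_isMatchingEdgeSet_of_injective_adj {V : Type*} {G : SimpleGraph V} {f : V → V}
    (hf : Function.Injective f) (hadj : ∀ v, G.Adj v (f v)) {s : Set V}
    (hs : IsIndepVertexSet G s) :
    ∃ M : Set (Sym2 V), IsMatchingEdgeSet G M ∧ M.ncard = s.ncard := by
  have hout : ∀ v ∈ s, f v ∉ s := fun v hv hfv => hs hv hfv (hadj v).ne (hadj v)
  refine ⟨(fun v => s(v, f v)) '' s, ⟨?_, ?_⟩, Set.InjOn.ncard_image ?_⟩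
  · rintro _ ⟨v, -, rfl⟩
    exact hadj v
  · rintro _ ⟨u, hu, rfl⟩ _ ⟨v, hv, rfl⟩ huv w hwu hwv
    have hne : u ≠ v := fun h => huv (by rw [h])
    rcases Sym2.mem_iff.1 hwu with rfl | rfl <;> rcases Sym2.mem_iff.1 hwv with h | h
    · exact hne h
    · exact hout v hv (h ▸ hu)
    · exact hout u hu (h ▸ hv)
    · exact hne (hf h)
  · intro u hu v hv huv
    rcases Sym2.mem_iff.1 ((show s(u, f u) = s(v, f v) from huv) ▸ Sym2.mem_mk_left u (f u)) with h | h
    · exact h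
    · exact absurd (h ▸ hu) (hout v hv)

/-- If `G` is a finite simple connected cubic graph, then `α(G) ≤ μ(G)`. -/
theorem indepNum_le_matchNum_of_connected_cubic {V : Type*} [Fintype V] (G : SimpleGraph V)
    (hconn : G.Connected) (hcubic : ∀ v : V, (G.neighborSet v).ncard = 3) :
    indepNum G ≤ matchNum G := by
  classical
  have hreg : G.IsRegularOfDegree 3 := fun v => by
    rw [← G.card_neighborSet_eq_degree, ← Nat.card_eq_fintype_card]
    exact hcubic v
  obtain ⟨f, hf, hadj⟩ := exists_injective_adj_of_isRegularOfDegree three_pos hreg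
  refine csSup_le ⟨0, ∅, by simp [IsIndepVertexSet], Set.ncard_empty V⟩ ?_
  rintro _ ⟨s, hs, rfl⟩
  refine le_csSup ⟨Nat.card (Sym2 V), ?_⟩ (exists_isMatchingEdgeSet_of_injective_adj hf hadj hs)
  rintro _ ⟨M, -, rfl⟩
  exact Set.ncard_le_card M
end

section
/- Let G be a finite simple graph that is r-regular for some r > 0, and let X be an independent set of vertices of G. Then there exists a matching M in G that saturates X, i.e., a set of pairwise disjoint edges of G such that every vertex of X is an endpoint of some edge of M. -/
/-- In a regular graph of positive degree, every set of vertices is at most as large as its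
neighborhood. -/
theorem SimpleGraph.IsRegularOfDegree.card_le_card_filter_adj {V : Type*} [Fintype V]
    {G : SimpleGraph V} [DecidableRel G.Adj] {r : ℕ} (hG : G.IsRegularOfDegree r) (hr : 0 < r)
    (A : Finset V) : A.card ≤ (Finset.univ.filter fun b => ∃ a ∈ A, G.Adj a b).card := by
  refine Nat.le_of_mul_le_mul_right (Finset.card_mul_le_card_mul G.Adj ?_ ?_) hr
  · intro a ha
    rw [← hG.degree_eq a, ← G.card_neighborFinset_eq_degree]
    refine Finset.card_le_card fun b hb => ?_
    rw [G.mem_neighborFinset] at hb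
    simpa [hb] using ⟨a, ha, hb⟩
  · intro b _
    rw [← hG.degree_eq b, ← G.card_neighborFinset_eq_degree]
    refine Finset.card_le_card fun a ha => ?_
    simpa using ((Finset.mem_bipartiteBelow G.Adj).mp ha).2.symm

/-- If `G` is `r`-regular with `r > 0` and `X` is an independent set of vertices, then
there is a matching of `G` saturating `X`. -/
theorem exists_matching_saturating_indep {V : Type*} [Fintype V] (G : SimpleGraph V)
    (r : ℕ) (hr : 0 < r) (hreg : ∀ v : V, (G.neighborSet v).ncard = r)
    (X : Set V) (hX : IsIndepVertexSet G X) :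
    ∃ M : Set (Sym2 V), IsMatchingEdgeSet G M ∧ ∀ x ∈ X, ∃ e ∈ M, x ∈ e := by
  classical
  have hG : G.IsRegularOfDegree r := fun v => by
    rw [← hreg v, Set.ncard_eq_toFinset_card', Set.toFinset_card, G.card_neighborSet_eq_degree]
  obtain ⟨f, hf, hadj⟩ :=
    (Fintype.all_card_le_filter_rel_iff_exists_injective fun (x : X) (v : V) => G.Adj x v).mp
      fun A => by
        simpa using hG.card_le_card_filter_adj hr (A.map (Function.Embedding.subtype (· ∈ X)))
  have hfX (x : X) : f x ∉ X := fun h => hX x.2 h (hadj x).ne (hadj x)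
  refine ⟨Set.range fun x : X => s(↑x, f x), ⟨?_, ?_⟩, fun x hx =>
    ⟨_, ⟨⟨x, hx⟩, rfl⟩, Sym2.mem_mk_left _ _⟩⟩
  · rintro _ ⟨x, rfl⟩
    exact hadj x
  · rintro _ ⟨x, rfl⟩ _ ⟨y, rfl⟩ hne v hvx hvy
    refine hne (congrArg (fun z : X => s(↑z, f z)) ?_)
    rcases Sym2.mem_iff.mp hvx with hx | hx <;> rcases Sym2.mem_iff.mp hvy with hy | hy
    · exact Subtype.ext (hx.symm.trans hy)
    · exact (hfX y (hy ▸ hx ▸ x.2)).elim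
    · exact (hfX x (hx ▸ hy ▸ y.2)).elim
    · exact hf (hx.symm.trans hy)
end

section
/- If G is a finite simple connected cubic graph (every vertex has degree exactly 3), then the independence number of G is at most 3/2 times the total domination number of G, i.e., 2·α(G) ≤ 3·γ_t(G). -/
/-- A total dominating set: every vertex of `G` has a neighbor in `D`. -/
def IsTotalDominatingSet {V : Type*} (G : SimpleGraph V) (D : Set V) : Prop :=
  ∀ v : V, ∃ u ∈ D, G.Adj u v

/-- The total domination number: minimum cardinality of a total dominating set. -/
noncomputable def totalDomNum {V : Type*} (G : SimpleGraph V) : ℕ :=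
  sInf {n : ℕ | ∃ D : Set V, IsTotalDominatingSet G D ∧ D.ncard = n}

/-- In a regular graph of positive degree, an independent set has at most half of the vertices. -/
theorem two_mul_ncard_le_card_of_isIndepVertexSet {V : Type*} [Fintype V] {G : SimpleGraph V}
    {d : ℕ} (hd : 0 < d) (hreg : ∀ v : V, (G.neighborSet v).ncard = d) {s : Set V}
    (hs : IsIndepVertexSet G s) : 2 * s.ncard ≤ Fintype.card V := by
  classical
  have hcount : s.toFinset.card * d ≤ s.toFinsetᶜ.card * d := by
    refine Finset.card_mul_le_card_mul G.Adj (fun a ha => ?_) (fun b _ => ?_)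
    · rw [← hreg a, ← Set.ncard_coe_finset]
      refine Set.ncard_le_ncard (fun v hv => ?_) (Set.toFinite _)
      rw [SimpleGraph.mem_neighborSet] at hv
      simp only [Finset.mem_coe, Finset.mem_bipartiteAbove, Finset.mem_compl, Set.mem_toFinset]
      exact ⟨fun hvs => hs (Set.mem_toFinset.1 ha) hvs hv.ne hv, hv⟩
    · rw [← hreg b, ← Set.ncard_coe_finset]
      refine Set.ncard_le_ncard (fun v hv => ?_) (Set.toFinite _)
      exact ((Finset.mem_bipartiteBelow G.Adj).1 hv).2.symm
  have hle := Nat.le_of_mul_le_mul_right hcount hd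
  have hadd := s.toFinset.card_add_card_compl
  rw [Set.ncard_eq_toFinset_card']
  omega

/-- In a `d`-regular graph, a total dominating set has at least `1 / d` of the vertices. -/
theorem card_le_mul_ncard_of_isTotalDominatingSet {V : Type*} [Fintype V] {G : SimpleGraph V}
    {d : ℕ} (hreg : ∀ v : V, (G.neighborSet v).ncard = d) {D : Set V}
    (hD : IsTotalDominatingSet G D) : Fintype.card V ≤ d * D.ncard := by
  classical
  have hcount : (Finset.univ : Finset V).card * 1 ≤ D.toFinset.card * d := by
    refine Finset.card_mul_le_card_mul G.Adj (fun a _ => ?_) (fun b _ => ?_)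
    · obtain ⟨u, huD, hu⟩ := hD a
      exact Finset.card_pos.2
        ⟨u, (Finset.mem_bipartiteAbove G.Adj).2 ⟨Set.mem_toFinset.2 huD, hu.symm⟩⟩
    · rw [← hreg b, ← Set.ncard_coe_finset]
      refine Set.ncard_le_ncard (fun v hv => ?_) (Set.toFinite _)
      exact ((Finset.mem_bipartiteBelow G.Adj).1 hv).2.symm
  rwa [mul_one, Finset.card_univ, mul_comm, ← Set.ncard_eq_toFinset_card'] at hcount

/-- If `G` is a finite simple connected cubic graph, then `α(G) ≤ (3/2)·γ_t(G)`,
i.e. `2·α(G) ≤ 3·γ_t(G)`. -/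
theorem two_indepNum_le_three_totalDomNum_of_connected_cubic {V : Type*} [Fintype V]
    (G : SimpleGraph V) (hconn : G.Connected)
    (hcubic : ∀ v : V, (G.neighborSet v).ncard = 3) :
    2 * indepNum G ≤ 3 * totalDomNum G := by
  have hindep : 2 * indepNum G ≤ Fintype.card V := by
    have hmem : indepNum G ∈ {n : ℕ | ∃ s : Set V, IsIndepVertexSet G s ∧ s.ncard = n} := by
      refine Nat.sSup_mem ⟨0, ∅, by simp [IsIndepVertexSet], by simp⟩ ⟨Fintype.card V, ?_⟩
      rintro _ ⟨s, -, rfl⟩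
      exact (Set.ncard_le_card s).trans_eq Nat.card_eq_fintype_card
    obtain ⟨s, hs, hcard⟩ := hmem
    exact hcard ▸ two_mul_ncard_le_card_of_isIndepVertexSet three_pos hcubic hs
  have hdom : Fintype.card V ≤ 3 * totalDomNum G := by
    have hmem : totalDomNum G ∈
        {n : ℕ | ∃ D : Set V, IsTotalDominatingSet G D ∧ D.ncard = n} := by
      refine Nat.sInf_mem ⟨_, Set.univ, fun v => ?_, rfl⟩
      obtain ⟨u, hu⟩ := Set.nonempty_of_ncard_ne_zero (by rw [hcubic v]; exact three_ne_zero)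
      exact ⟨u, Set.mem_univ u, (G.mem_neighborSet v u |>.1 hu).symm⟩
    obtain ⟨D, hD, hcard⟩ := hmem
    exact hcard ▸ card_le_mul_ncard_of_isTotalDominatingSet hcubic hD
  exact hindep.trans hdom
end

section
/- If G is a finite simple connected claw-free graph (no induced subgraph isomorphic to the complete bipartite graph K_{1,3}), then the independence number of G is at most the 2-domination number of G, i.e., α(G) ≤ γ_2(G). -/
/-- `G` is claw-free: it contains no induced `K_{1,3}`, i.e. no vertex with three
pairwise distinct, pairwise non-adjacent neighbors. -/
def ClawFree {V : Type*} (G : SimpleGraph V) : Prop :=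
  ¬ ∃ c a b d : V, a ≠ b ∧ a ≠ d ∧ b ≠ d ∧
    G.Adj c a ∧ G.Adj c b ∧ G.Adj c d ∧ ¬ G.Adj a b ∧ ¬ G.Adj a d ∧ ¬ G.Adj b d

/-- A 2-dominating set: every vertex not in `D` has at least two neighbors in `D`. -/
def IsTwoDominatingSet {V : Type*} (G : SimpleGraph V) (D : Set V) : Prop :=
  ∀ v ∉ D, ∃ u ∈ D, ∃ w ∈ D, u ≠ w ∧ G.Adj u v ∧ G.Adj w v

/-- The 2-domination number: minimum cardinality of a 2-dominating set. -/
noncomputable def twoDomNum {V : Type*} (G : SimpleGraph V) : ℕ :=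
  sInf {n : ℕ | ∃ D : Set V, IsTwoDominatingSet G D ∧ D.ncard = n}

/-- In a claw-free graph, the cardinality of any independent set is at most that of any
2-dominating set. -/
theorem ClawFree.ncard_le_ncard {V : Type*} [Finite V] {G : SimpleGraph V} (hcf : ClawFree G)
    {s D : Set V} (hs : IsIndepVertexSet G s) (hD : IsTwoDominatingSet G D) :
    s.ncard ≤ D.ncard := by
  classical
  have := Fintype.ofFinite V
  have key : (s \ D).toFinset.card * 2 ≤ (D \ s).toFinset.card * 2 := by
    refine Finset.card_mul_le_card_mul G.Adj (fun v hv => ?_) (fun d hd => ?_)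
    · rw [Set.mem_toFinset] at hv
      obtain ⟨u, hu, w, hw, huw, hau, haw⟩ := hD v hv.2
      refine Finset.one_lt_card.2 ⟨u, ?_, w, ?_, huw⟩
      · simp only [Finset.mem_bipartiteAbove, Set.mem_toFinset]
        exact ⟨⟨hu, fun h => hs h hv.1 hau.ne hau⟩, hau.symm⟩
      · simp only [Finset.mem_bipartiteAbove, Set.mem_toFinset]
        exact ⟨⟨hw, fun h => hs h hv.1 haw.ne haw⟩, haw.symm⟩
    · by_contra! h
      obtain ⟨a, b, c, ha, hb, hc, hab, hac, hbc⟩ := Finset.two_lt_card_iff.1 h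
      simp only [Finset.mem_bipartiteBelow, Set.mem_toFinset] at ha hb hc
      exact hcf ⟨d, a, b, c, hab, hac, hbc, ha.2.symm, hb.2.symm, hc.2.symm,
        hs ha.1.1 hb.1.1 hab, hs ha.1.1 hc.1.1 hac, hs hb.1.1 hc.1.1 hbc⟩
  rw [← Set.ncard_eq_toFinset_card', ← Set.ncard_eq_toFinset_card'] at key
  rw [Set.ncard_le_ncard_iff_ncard_sdiff_le_ncard_sdiff]
  omega

/-- If `G` is a finite simple connected claw-free graph, then `α(G) ≤ γ₂(G)`. -/
theorem indepNum_le_twoDomNum_of_connected_clawFree {V : Type*} [Fintype V]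
    (G : SimpleGraph V) (hconn : G.Connected) (hcf : ClawFree G) :
    indepNum G ≤ twoDomNum G := by
  refine csSup_le ⟨0, ∅, by simp [IsIndepVertexSet], by simp⟩ ?_
  rintro _ ⟨s, hs, rfl⟩
  refine le_csInf ⟨_, Set.univ, by simp [IsTwoDominatingSet], rfl⟩ ?_
  rintro _ ⟨D, hD, rfl⟩
  exact hcf.ncard_le_ncard hs hD
end

section
/- If G is a finite simple connected cubic graph (every vertex has degree exactly 3), then the edge domination number of G is at least 3/5 times the matching number of G, i.e., 5·γ_e(G) ≥ 3·μ(G). -/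
/-- An edge dominating set: a set `F` of edges of `G` such that every edge of `G`
shares an endpoint with some edge of `F`. -/
def IsEdgeDominatingSet {V : Type*} (G : SimpleGraph V) (F : Set (Sym2 V)) : Prop :=
  F ⊆ G.edgeSet ∧ ∀ e ∈ G.edgeSet, ∃ f ∈ F, ∃ v : V, v ∈ e ∧ v ∈ f

/-- The edge domination number: minimum cardinality of an edge dominating set. -/
noncomputable def edgeDomNum {V : Type*} (G : SimpleGraph V) : ℕ :=
  sInf {n : ℕ | ∃ F : Set (Sym2 V), IsEdgeDominatingSet G F ∧ F.ncard = n}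

/-- A matching with `k` edges covers `2 * k` vertices. -/
theorem IsMatchingEdgeSet.two_mul_ncard_le {V : Type*} [Fintype V] {G : SimpleGraph V}
    {M : Set (Sym2 V)} (hM : IsMatchingEdgeSet G M) : 2 * M.ncard ≤ Fintype.card V := by
  classical
  obtain ⟨M, rfl⟩ := M.toFinite.exists_finset_coe
  have hdisj : (M : Set (Sym2 V)).PairwiseDisjoint Sym2.toFinset := by
    intro e he f hf hef
    refine Finset.disjoint_left.2 fun v hve hvf => ?_
    exact hM.2 he hf hef v (Sym2.mem_toFinset.1 hve) (Sym2.mem_toFinset.1 hvf)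
  have hcard : ∀ e ∈ M, e.toFinset.card = 2 := fun e he =>
    Sym2.card_toFinset_of_not_isDiag e (G.not_isDiag_of_mem_edgeSet (hM.1 he))
  calc 2 * (M : Set (Sym2 V)).ncard = ∑ e ∈ M, e.toFinset.card := by
        rw [Finset.sum_congr rfl hcard, Set.ncard_coe_finset, Finset.sum_const, smul_eq_mul,
          mul_comm]
    _ = (M.biUnion Sym2.toFinset).card := (Finset.card_biUnion hdisj).symm
    _ ≤ Fintype.card V := Finset.card_le_univ _

open Classical Finset in
/-- In a `d`-regular graph an edge meets at most `2 * d - 1` edges, itself included. -/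
theorem SimpleGraph.IsRegularOfDegree.card_edges_meeting_add_one_le {V : Type*} [Fintype V]
    {G : SimpleGraph V} {d : ℕ} (hG : G.IsRegularOfDegree d) {f : Sym2 V} (hf : f ∈ G.edgeSet) :
    #{e ∈ G.edgeFinset | ∃ v, v ∈ e ∧ v ∈ f} + 1 ≤ 2 * d := by
  induction f using Sym2.ind with
  | _ a b =>
    have hsub : ({e ∈ G.edgeFinset | ∃ v, v ∈ e ∧ v ∈ s(a, b)} : Finset (Sym2 V)) ⊆
        G.incidenceFinset a ∪ G.incidenceFinset b := by
      intro e he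
      obtain ⟨heG, v, hve, hv⟩ := Finset.mem_filter.1 he
      rw [SimpleGraph.mem_edgeFinset] at heG
      rw [Finset.mem_union, SimpleGraph.mem_incidenceFinset, SimpleGraph.mem_incidenceFinset]
      rcases Sym2.mem_iff.1 hv with rfl | rfl
      · exact Or.inl ⟨heG, hve⟩
      · exact Or.inr ⟨heG, hve⟩
    have hinter : 0 < #(G.incidenceFinset a ∩ G.incidenceFinset b) := by
      refine Finset.card_pos.2 ⟨s(a, b), ?_⟩
      rw [Finset.mem_inter, SimpleGraph.mem_incidenceFinset, SimpleGraph.mem_incidenceFinset]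
      exact ⟨⟨hf, Sym2.mem_mk_left a b⟩, ⟨hf, Sym2.mem_mk_right a b⟩⟩
    have hunion := Finset.card_union_add_card_inter (G.incidenceFinset a) (G.incidenceFinset b)
    rw [G.card_incidenceFinset_eq_degree, G.card_incidenceFinset_eq_degree, hG a, hG b] at hunion
    have := Finset.card_le_card hsub
    omega

open Classical Finset in
/-- In a `d`-regular graph an edge dominating set `F` satisfies `|E| ≤ (2 * d - 1) * |F|`. -/
theorem IsEdgeDominatingSet.card_edgeFinset_le {V : Type*} [Fintype V] {G : SimpleGraph V}
    {d : ℕ} (hG : G.IsRegularOfDegree d) {F : Set (Sym2 V)} (hF : IsEdgeDominatingSet G F) :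
    #G.edgeFinset ≤ F.ncard * (2 * d - 1) := by
  obtain ⟨F, rfl⟩ := F.toFinite.exists_finset_coe
  have hsub : G.edgeFinset ⊆
      F.biUnion fun f => {e ∈ G.edgeFinset | ∃ v, v ∈ e ∧ v ∈ f} := by
    intro e he
    obtain ⟨f, hf, v, hv⟩ := hF.2 e (SimpleGraph.mem_edgeFinset.1 he)
    exact Finset.mem_biUnion.2 ⟨f, hf, Finset.mem_filter.2 ⟨he, v, hv⟩⟩
  rw [Set.ncard_coe_finset]
  refine (Finset.card_le_card hsub).trans (Finset.card_biUnion_le_card_mul _ _ _ fun f hf => ?_)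
  exact Nat.le_sub_one_of_lt (hG.card_edges_meeting_add_one_le (hF.1 hf))

/-- If `G` is a finite simple connected cubic graph, then `γ_e(G) ≥ (3/5)·μ(G)`,
i.e. `5·γ_e(G) ≥ 3·μ(G)`. -/
theorem five_edgeDomNum_ge_three_matchNum_of_connected_cubic {V : Type*} [Fintype V]
    (G : SimpleGraph V) (hconn : G.Connected)
    (hcubic : ∀ v : V, (G.neighborSet v).ncard = 3) :
    3 * matchNum G ≤ 5 * edgeDomNum G := by
  classical
  have hG : G.IsRegularOfDegree 3 := fun v => by
    rw [← hcubic v, Set.ncard_eq_toFinset_card', ← SimpleGraph.neighborFinset_def,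
      SimpleGraph.card_neighborFinset_eq_degree]
  obtain ⟨M, hM, hMcard⟩ : matchNum G ∈
      {n : ℕ | ∃ M : Set (Sym2 V), IsMatchingEdgeSet G M ∧ M.ncard = n} := by
    refine Nat.sSup_mem ⟨0, ∅, ⟨Set.empty_subset _, Set.pairwise_empty _⟩, Set.ncard_empty _⟩
      ⟨Fintype.card V, ?_⟩
    rintro _ ⟨M, hM, rfl⟩
    have := hM.two_mul_ncard_le
    omega
  obtain ⟨F, hF, hFcard⟩ : edgeDomNum G ∈
      {n : ℕ | ∃ F : Set (Sym2 V), IsEdgeDominatingSet G F ∧ F.ncard = n} :=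
    Nat.sInf_mem ⟨_, G.edgeSet, ⟨subset_rfl, fun e he =>
      ⟨e, he, _, e.out_fst_mem, e.out_fst_mem⟩⟩, rfl⟩
  have hvertices := hM.two_mul_ncard_le
  have hedges := hF.card_edgeFinset_le hG
  have hsum := G.sum_degrees_eq_twice_card_edges
  rw [Finset.sum_congr rfl fun v _ => hG v, Finset.sum_const, Finset.card_univ,
    smul_eq_mul] at hsum
  rw [← hMcard, ← hFcard]
  have : Fintype.card V * 3 ≤ 2 * (F.ncard * 5) := by
    rw [hsum]
    convert Nat.mul_le_mul_left 2 hedges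
  omega
end
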